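/- arXiv:1701.03986 — 5 statements merged into one kernel-verified Lean document; each statement's English description precedes it below -/
import Mathlib

section
/- Let q be a prime power, Q = q², and let n be a positive integer with gcd(n, q) = 1. Let g(x) be a monic divisor of x^n − 1 in GF(Q)[x] and let C be the cyclic code of length n over GF(Q) with generator polynomial g(x). Then C is a Hermitian LCD code if and only if for every monic irreducible polynomial p(x) dividing x^n − 1 in GF(Q)[x], p(x) divides g(x) exactly when p̄*(x) divides g(x). -/
open Polynomial

noncomputable section

/-- The cyclic shift of a vector: `(c₀,…,c_{n−1}) ↦ (c_{n−1},c₀,…,c_{n−2})`. -/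
def cyclicShift {F : Type*} {n : ℕ} (c : Fin n → F) : Fin n → F :=
  fun i => c ⟨(i.val + (n - 1)) % n, Nat.mod_lt _ i.pos⟩

/-- A linear code (submodule of `F^n`) is cyclic if it is stable under the cyclic shift. -/
def IsCyclicCode {F : Type*} [Field F] {n : ℕ} (C : Submodule F (Fin n → F)) : Prop :=
  ∀ c ∈ C, cyclicShift c ∈ C

/-- The Hermitian dual `C^⊥H = {b : ∑ i, b i * (c i)^q = 0 for all c ∈ C}`. -/
def hermDualSet {F : Type*} [Field F] (q : ℕ) {n : ℕ} (C : Set (Fin n → F)) :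
    Set (Fin n → F) :=
  {b | ∀ c ∈ C, ∑ i, b i * (c i) ^ q = 0}

/-- A code is Hermitian LCD if `C ∩ C^⊥H = {0}`. -/
def IsHermitianLCD {F : Type*} [Field F] (q : ℕ) {n : ℕ} (C : Set (Fin n → F)) : Prop :=
  C ∩ hermDualSet q C = {0}

/-- The polynomial `c₀ + c₁ x + ⋯ + c_{n−1} x^{n−1}` associated with a vector. -/
def polyOfVec {F : Type*} [Field F] {n : ℕ} (c : Fin n → F) : Polynomial F :=
  ∑ i : Fin n, Polynomial.C (c i) * Polynomial.X ^ (i : ℕ)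

/-- The cyclic code of length `n` with generator polynomial `g` (for `g ∣ xⁿ − 1`):
vectors whose associated polynomial (of degree `< n`) is divisible by `g`. -/
def cyclicCodeOf {F : Type*} [Field F] (n : ℕ) (g : Polynomial F) :
    Submodule F (Fin n → F) where
  carrier := {c | g ∣ polyOfVec c}
  add_mem' := by
    intro a b ha hb
    have h : polyOfVec (a + b) = polyOfVec a + polyOfVec b := by
      simp [polyOfVec, add_mul, Finset.sum_add_distrib]
    simpa [Set.mem_setOf_eq, h] using dvd_add ha hb
  zero_mem' := by simp [polyOfVec]
  smul_mem' := by
    intro r c hc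
    have h : polyOfVec (r • c) = Polynomial.C r * polyOfVec c := by
      simp [polyOfVec, Finset.mul_sum, mul_assoc]
    simpa [Set.mem_setOf_eq, h] using hc.mul_left (Polynomial.C r)

/-- `f̄`: the polynomial obtained by raising every coefficient of `f` to the `q`-th power. -/
def conjPoly {F : Type*} [Field F] (q : ℕ) (f : Polynomial F) : Polynomial F :=
  f.sum fun i a => Polynomial.C (a ^ q) * Polynomial.X ^ i

/-- The reciprocal polynomial `f*(x) = f₀⁻¹ xᵗ f(1/x)`. -/
def recipPoly {F : Type*} [Field F] (f : Polynomial F) : Polynomial F :=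
  Polynomial.C (f.coeff 0)⁻¹ * f.reverse

/-- The `Q`-cyclotomic coset of `s` modulo `n`, as a subset of `{0,…,n−1} ⊆ ℕ`
(`s` is taken as an integer so that negative indices are allowed). -/
def cycCoset (Q n : ℕ) (s : ℤ) : Set ℕ :=
  {x | x < n ∧ ∃ j : ℕ, (x : ℤ) ≡ s * (Q : ℤ) ^ j [ZMOD n]}

end

/-- The `φ`-semilinear ring endomorphism of `F[X]` that sends `X` to `X ^ (n - 1)`. Modulo
`X ^ n - 1` it is the involution sending `X` to its inverse. -/
noncomputable def conjInv {F : Type*} [Field F] (φ : F →+* F) (n : ℕ) : F[X] →+* F[X] :=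
  eval₂RingHom (C.comp φ) (X ^ (n - 1))

section ConjInv

variable {F : Type*} [Field F] {φ : F →+* F} {n : ℕ}

lemma conjInv_C (a : F) : conjInv φ n (C a) = C (φ a) := by
  simp [conjInv]

lemma conjInv_X : conjInv φ n X = X ^ (n - 1) := by
  simp [conjInv]

lemma monic_X_pow_sub_one (hn : 0 < n) : (X ^ n - 1 : F[X]).Monic := by
  simpa using monic_X_pow_sub_C (1 : F) hn.ne'

lemma X_pow_sub_one_dvd_X_pow_sub_X_pow {i j : ℕ} (h : i ≡ j [MOD n]) :
    (X ^ n - 1 : F[X]) ∣ X ^ i - X ^ j := by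
  wlog hij : j ≤ i generalizing i j
  · rw [dvd_sub_comm]
    exact this h.symm (by omega)
  obtain ⟨k, hk⟩ := (Nat.modEq_iff_dvd' hij).mp h.symm
  obtain rfl : i = j + n * k := by omega
  have h1 : (X ^ n - 1 : F[X]) ∣ (X ^ n) ^ k - 1 := by
    simpa using sub_dvd_pow_sub_pow (X ^ n : F[X]) 1 k
  convert h1.mul_left (X ^ j) using 1
  ring

lemma X_pow_sub_one_dvd_conjInv_self :
    (X ^ n - 1 : F[X]) ∣ conjInv φ n (X ^ n - 1) := by
  have h : conjInv φ n (X ^ n - 1) = X ^ ((n - 1) * n) - X ^ 0 := by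
    simp [conjInv_X, pow_mul]
  rw [h]
  exact X_pow_sub_one_dvd_X_pow_sub_X_pow (by simp [Nat.ModEq])

lemma X_pow_sub_one_dvd_conjInv_of_dvd {f : F[X]} (h : X ^ n - 1 ∣ f) :
    X ^ n - 1 ∣ conjInv φ n f :=
  X_pow_sub_one_dvd_conjInv_self.trans (map_dvd (conjInv φ n) h)

lemma pred_mul_pred_modEq_one (hn : 0 < n) : (n - 1) * (n - 1) ≡ 1 [MOD n] := by
  obtain ⟨m, rfl⟩ : ∃ m, n = m + 1 := ⟨n - 1, by omega⟩
  rw [← Int.natCast_modEq_iff]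
  refine (Int.modEq_iff_dvd.mpr ⟨1 - m, ?_⟩)
  push_cast [Nat.add_sub_cancel]
  ring

lemma X_pow_sub_one_dvd_conjInv_conjInv_sub (hn : 0 < n) (hφ : ∀ a, φ (φ a) = a) (f : F[X]) :
    X ^ n - 1 ∣ conjInv φ n (conjInv φ n f) - f := by
  induction f using Polynomial.induction_on' with
  | add f g hf hg =>
    convert dvd_add hf hg using 1
    simp only [map_add]
    ring
  | monomial i a =>
    have h : conjInv φ n (conjInv φ n (monomial i a)) - monomial i a =
        C a * (X ^ ((n - 1) * (n - 1) * i) - X ^ (1 * i)) := by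
      rw [← C_mul_X_pow_eq_monomial]
      simp only [map_mul, map_pow, conjInv_C, conjInv_X, hφ]
      ring
    rw [h]
    exact (X_pow_sub_one_dvd_X_pow_sub_X_pow
      ((pred_mul_pred_modEq_one hn).mul_right i)).mul_left _

lemma reverse_X_pow_sub_one : (X ^ n - 1 : F[X]).reverse = -(X ^ n - 1) := by
  have h : (X ^ n - 1 : F[X]).natDegree = n := by
    simpa using natDegree_X_pow_sub_C (R := F) (n := n) (r := 1)
  rw [reverse, h, reflect_sub, ← one_mul (X ^ n), ← C_1, reflect_C_mul_X_pow]
  simp [revAt_le]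

lemma reverse_dvd_X_pow_sub_one {p : F[X]} (hp : p ∣ X ^ n - 1) : p.reverse ∣ X ^ n - 1 := by
  obtain ⟨r, hr⟩ := hp
  rw [← dvd_neg, ← reverse_X_pow_sub_one, hr, reverse_mul_of_domain]
  exact dvd_mul_right _ _

lemma map_dvd_X_pow_sub_one {p : F[X]} (hp : p ∣ X ^ n - 1) : p.map φ ∣ X ^ n - 1 := by
  simpa using Polynomial.map_dvd φ hp

lemma X_pow_sub_one_dvd_reverse_mul_sub (hn : 0 < n) (p : F[X]) :
    X ^ n - 1 ∣ (p.map φ).reverse * (X ^ (n - 1)) ^ (p.map φ).natDegree - conjInv φ n p := by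
  set N : F[X] := X ^ n - 1
  have hroot : AdjoinRoot.root N * AdjoinRoot.root N ^ (n - 1) = 1 := by
    rw [← pow_succ', Nat.sub_add_cancel hn, ← AdjoinRoot.mk_X, ← map_pow,
      ← map_one (AdjoinRoot.mk N), AdjoinRoot.mk_eq_mk]
  let _ : Invertible (AdjoinRoot.root N ^ (n - 1)) := ⟨AdjoinRoot.root N, hroot, by rwa [mul_comm]⟩
  have h := eval₂_reverse_mul_pow (AdjoinRoot.of N) (AdjoinRoot.root N ^ (n - 1)) (p.map φ)
  rw [← AdjoinRoot.mk_eq_mk, map_mul, map_pow, map_pow, AdjoinRoot.mk_X]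
  convert h using 1
  · congr 1
    exact (AdjoinRoot.aeval_eq _).symm
  · rw [eval₂_map, conjInv, coe_eval₂RingHom, hom_eval₂, map_pow, AdjoinRoot.mk_X]
    rfl

lemma dvd_of_dvd_mul_X_pow (hn : 0 < n) {d a : F[X]} {k : ℕ} (hd : d ∣ X ^ n - 1)
    (h : d ∣ a * X ^ k) : d ∣ a := by
  have hX : IsCoprime (X ^ n - 1 : F[X]) X :=
    ⟨-1, X ^ (n - 1), by rw [← pow_succ, Nat.sub_add_cancel hn]; ring⟩
  exact (hX.of_isCoprime_of_dvd_left hd).pow_right.dvd_of_dvd_mul_right h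

lemma reverse_map_dvd_conjInv (hn : 0 < n) {p : F[X]} (hp : p ∣ X ^ n - 1) :
    (p.map φ).reverse ∣ conjInv φ n p :=
  (dvd_iff_dvd_of_dvd_sub ((reverse_dvd_X_pow_sub_one (map_dvd_X_pow_sub_one hp)).trans
    (X_pow_sub_one_dvd_reverse_mul_sub hn p))).mp (dvd_mul_right _ _)

lemma dvd_conjInv_reverse_map (hn : 0 < n) (hφ : ∀ a, φ (φ a) = a) {p : F[X]}
    (hp : p ∣ X ^ n - 1) : p ∣ conjInv φ n (p.map φ).reverse := by
  have h := X_pow_sub_one_dvd_conjInv_of_dvd (φ := φ)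
    (X_pow_sub_one_dvd_reverse_mul_sub (φ := φ) hn p)
  rw [map_sub] at h
  have h1 := (dvd_iff_dvd_of_dvd_sub (hp.trans h)).mpr ((dvd_iff_dvd_of_dvd_sub
    (hp.trans (X_pow_sub_one_dvd_conjInv_conjInv_sub hn hφ p))).mpr dvd_rfl)
  simp only [map_mul, map_pow, conjInv_X, ← pow_mul] at h1
  exact dvd_of_dvd_mul_X_pow hn hp h1

lemma reverse_map_dvd_iff (hn : 0 < n) (hφ : ∀ a, φ (φ a) = a) {p : F[X]}
    (hp : p ∣ X ^ n - 1) (g : F[X]) : (p.map φ).reverse ∣ g ↔ p ∣ conjInv φ n g := by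
  refine ⟨fun h => (dvd_conjInv_reverse_map hn hφ hp).trans (map_dvd (conjInv φ n) h), fun h => ?_⟩
  exact (dvd_iff_dvd_of_dvd_sub ((reverse_dvd_X_pow_sub_one (map_dvd_X_pow_sub_one hp)).trans
    (X_pow_sub_one_dvd_conjInv_conjInv_sub hn hφ g))).mp
    ((reverse_map_dvd_conjInv hn hp).trans (map_dvd (conjInv φ n) h))

/-- The constant coefficient of the remainder modulo `X ^ n - 1`. -/
noncomputable def constCoeffMod (F : Type*) [Field F] (n : ℕ) : F[X] →ₗ[F] F :=
  lcoeff F 0 ∘ₗ modByMonicHom (X ^ n - 1)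

lemma constCoeffMod_eq_of_dvd_sub (hn : 0 < n) {f g : F[X]} (h : X ^ n - 1 ∣ f - g) :
    constCoeffMod F n f = constCoeffMod F n g := by
  simp [constCoeffMod, modByMonicHom_apply, modByMonic_eq_of_dvd_sub (monic_X_pow_sub_one hn) h]

lemma degree_X_pow_sub_one (hn : 0 < n) : (X ^ n - 1 : F[X]).degree = n := by
  simpa using degree_X_pow_sub_C hn (1 : F)

lemma constCoeffMod_X_pow (hn : 0 < n) (i : ℕ) :
    constCoeffMod F n (X ^ i) = if n ∣ i then 1 else 0 := by
  rw [constCoeffMod_eq_of_dvd_sub hn (X_pow_sub_one_dvd_X_pow_sub_X_pow (Nat.mod_modEq i n).symm)]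
  have h : (X ^ (i % n) : F[X]) %ₘ (X ^ n - 1) = X ^ (i % n) := by
    rw [modByMonic_eq_self_iff (monic_X_pow_sub_one hn), degree_X_pow_sub_one hn, degree_X_pow]
    exact_mod_cast Nat.mod_lt i hn
  simp [constCoeffMod, modByMonicHom_apply, h, coeff_X_pow, Nat.dvd_iff_mod_eq_zero, eq_comm]

lemma degree_polyOfVec_lt (c : Fin n → F) : (polyOfVec c).degree < n :=
  (degree_sum_le _ _).trans_lt <| (Finset.sup_lt_iff (WithBot.bot_lt_coe n)).mpr fun i _ =>
    (degree_C_mul_X_pow_le _ _).trans_lt (Nat.cast_lt.mpr i.isLt)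

lemma coeff_polyOfVec (c : Fin n → F) (i : Fin n) : (polyOfVec c).coeff i = c i := by
  simp [polyOfVec, coeff_X_pow, Fin.val_inj]

lemma polyOfVec_coeff {f : F[X]} (hf : f.degree < n) :
    polyOfVec (fun i : Fin n => f.coeff i) = f := by
  ext k
  by_cases hk : k < n
  · exact coeff_polyOfVec (fun i : Fin n => f.coeff i) ⟨k, hk⟩
  · have hk' : (n : WithBot ℕ) ≤ k := by exact_mod_cast not_lt.mp hk
    rw [coeff_eq_zero_of_degree_lt (hf.trans_le hk'),
      coeff_eq_zero_of_degree_lt ((degree_polyOfVec_lt _).trans_le hk')]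

lemma exists_dvd_polyOfVec_sub (hn : 0 < n) (f : F[X]) :
    ∃ c : Fin n → F, X ^ n - 1 ∣ polyOfVec c - f := by
  refine ⟨fun i => (f %ₘ (X ^ n - 1)).coeff i, ?_⟩
  rw [polyOfVec_coeff]
  · exact dvd_modByMonic_sub _ _
  · rw [← degree_X_pow_sub_one (F := F) hn]
    exact degree_modByMonic_lt _ (monic_X_pow_sub_one hn)

lemma eq_zero_of_dvd_polyOfVec (hn : 0 < n) {c : Fin n → F} (h : X ^ n - 1 ∣ polyOfVec c) :
    c = 0 := by
  have h0 := eq_zero_of_dvd_of_degree_lt h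
    ((degree_polyOfVec_lt c).trans_eq (degree_X_pow_sub_one hn).symm)
  ext i
  rw [← coeff_polyOfVec c i, h0]
  simp

lemma dvd_add_pred_mul_iff (i j : Fin n) : n ∣ (i : ℕ) + (n - 1) * j ↔ i = j := by
  have hn : 1 ≤ n := i.pos
  have h : ((i : ℕ) + (n - 1) * j) + j = i + n * j := by
    rw [add_assoc, ← Nat.succ_mul, Nat.succ_eq_add_one, Nat.sub_add_cancel hn]
  rw [← Nat.modEq_zero_iff_dvd, ← Nat.ModEq.add_iff_right (Nat.ModEq.refl (j : ℕ)), h, zero_add]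
  simp [Nat.ModEq, Nat.mod_eq_of_lt i.isLt, Nat.mod_eq_of_lt j.isLt, Fin.val_inj]

/-- The Hermitian form is the constant coefficient of `b(X) * c̄(X⁻¹)` modulo `X ^ n - 1`. -/
lemma constCoeffMod_mul_conjInv (hn : 0 < n) (b c : Fin n → F) :
    constCoeffMod F n (polyOfVec b * conjInv φ n (polyOfVec c)) = ∑ i, b i * φ (c i) := by
  have h : polyOfVec b * conjInv φ n (polyOfVec c) =
      ∑ i, ∑ j, (b i * φ (c j)) • X ^ ((i : ℕ) + (n - 1) * j) := by
    simp only [polyOfVec, map_sum, map_mul, map_pow, conjInv_C, conjInv_X, Finset.sum_mul_sum,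
      smul_eq_C_mul]
    refine Finset.sum_congr rfl fun i _ => Finset.sum_congr rfl fun j _ => ?_
    ring
  rw [h]
  simp [constCoeffMod_X_pow hn, dvd_add_pred_mul_iff]

lemma dvd_of_forall_constCoeffMod_mul_X_pow_eq_zero (hn : 0 < n) {f : F[X]}
    (h : ∀ k, constCoeffMod F n (f * X ^ k) = 0) : X ^ n - 1 ∣ f := by
  obtain ⟨c, hc⟩ := exists_dvd_polyOfVec_sub hn f
  have hc0 : c = 0 := by
    ext j
    have h1 : X ^ n - 1 ∣ polyOfVec c * X ^ ((n - 1) * j) - f * X ^ ((n - 1) * j) := by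
      rw [← sub_mul]
      exact hc.mul_right _
    have h2 := constCoeffMod_eq_of_dvd_sub hn h1
    have h3 : polyOfVec c * X ^ ((n - 1) * (j : ℕ)) =
        ∑ i, c i • X ^ ((i : ℕ) + (n - 1) * j) := by
      simp only [polyOfVec, Finset.sum_mul, smul_eq_C_mul]
      exact Finset.sum_congr rfl fun i _ => by ring
    rw [h, h3] at h2
    simpa [constCoeffMod_X_pow hn, dvd_add_pred_mul_iff] using h2
  simpa [hc0, polyOfVec] using hc

lemma mem_cyclicCodeOf {g : F[X]} {c : Fin n → F} : c ∈ cyclicCodeOf n g ↔ g ∣ polyOfVec c :=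
  Iff.rfl

lemma mem_hermDualSet_cyclicCodeOf_iff {q : ℕ} (hn : 0 < n) (hφq : ∀ a, φ a = a ^ q)
    (hφ : ∀ a, φ (φ a) = a) {g : F[X]} (hg : g ∣ X ^ n - 1) (b : Fin n → F) :
    b ∈ hermDualSet q (cyclicCodeOf n g : Set (Fin n → F)) ↔
      X ^ n - 1 ∣ polyOfVec b * conjInv φ n g := by
  have hform : ∀ c : Fin n → F, ∑ i, b i * c i ^ q =
      constCoeffMod F n (polyOfVec b * conjInv φ n (polyOfVec c)) := fun c => by
    simp [constCoeffMod_mul_conjInv hn, hφq]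
  constructor
  · intro hb
    refine dvd_of_forall_constCoeffMod_mul_X_pow_eq_zero hn fun k => ?_
    obtain ⟨c, hc⟩ := exists_dvd_polyOfVec_sub hn (g * conjInv φ n (X ^ k))
    have hgc : g ∣ polyOfVec c :=
      (dvd_iff_dvd_of_dvd_sub (hg.trans hc)).mpr (dvd_mul_right _ _)
    rw [← hb c hgc, hform]
    refine constCoeffMod_eq_of_dvd_sub hn ?_
    have h1 := X_pow_sub_one_dvd_conjInv_of_dvd (φ := φ) hc
    have h2 := X_pow_sub_one_dvd_conjInv_conjInv_sub hn hφ (X ^ k)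
    rw [map_sub, map_mul] at h1
    rw [dvd_sub_comm]
    convert dvd_add (h1.mul_left (polyOfVec b))
      (h2.mul_left (polyOfVec b * conjInv φ n g)) using 1
    ring
  · intro hb c hc
    obtain ⟨f, hf⟩ := mem_cyclicCodeOf.mp hc
    rw [hform, hf, map_mul (conjInv φ n), ← mul_assoc,
      constCoeffMod_eq_of_dvd_sub hn (g := 0) (by simpa using hb.mul_right _), map_zero]

lemma isHermitianLCD_cyclicCodeOf_iff {q : ℕ} (hn : 0 < n) (hφq : ∀ a, φ a = a ^ q)
    (hφ : ∀ a, φ (φ a) = a) {g : F[X]} (hg : g ∣ X ^ n - 1) :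
    IsHermitianLCD q (cyclicCodeOf n g : Set (Fin n → F)) ↔
      ∀ f, g ∣ f → X ^ n - 1 ∣ f * conjInv φ n g → X ^ n - 1 ∣ f := by
  constructor
  · intro h f hgf hf
    obtain ⟨b, hb⟩ := exists_dvd_polyOfVec_sub hn f
    have hmem : b ∈ (cyclicCodeOf n g : Set (Fin n → F)) ∩
        hermDualSet q (cyclicCodeOf n g : Set (Fin n → F)) := by
      refine ⟨(dvd_iff_dvd_of_dvd_sub (hg.trans hb)).mpr hgf,
        (mem_hermDualSet_cyclicCodeOf_iff hn hφq hφ hg b).mpr ?_⟩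
      refine (dvd_iff_dvd_of_dvd_sub ?_).mpr hf
      rw [← sub_mul]
      exact hb.mul_right _
    rw [h, Set.mem_singleton_iff] at hmem
    simpa [hmem, polyOfVec] using hb
  · intro h
    refine Set.eq_singleton_iff_unique_mem.mpr ⟨⟨Submodule.zero_mem _, ?_⟩, ?_⟩
    · simp [hermDualSet]
    · rintro b ⟨hb, hb'⟩
      exact eq_zero_of_dvd_polyOfVec hn
        (h _ hb ((mem_hermDualSet_cyclicCodeOf_iff hn hφq hφ hg b).mp hb'))

end ConjInv

lemma Squarefree.dvd_of_forall_irreducible_dvd {F : Type*} [Field F] {N f : F[X]}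
    (hN : Squarefree N) (h : ∀ p : F[X], p.Monic → Irreducible p → p ∣ N → p ∣ f) : N ∣ f := by
  classical
  obtain ⟨e, he⟩ := EuclideanDomain.gcd_dvd_left N f
  by_cases hu : IsUnit e
  · rw [he]
    exact hu.mul_right_dvd.mpr (EuclideanDomain.gcd_dvd_right N f)
  · obtain ⟨p, hpm, hp, hpe⟩ := exists_monic_irreducible_factor e hu
    have hpN : p ∣ N := he ▸ hpe.mul_left _
    have hpd := EuclideanDomain.dvd_gcd hpN (h p hpm hp hpN)
    exact absurd (hN p (he ▸ mul_dvd_mul hpd hpe)) hp.not_isUnit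

lemma forall_dvd_mul_imp_dvd_iff {F : Type*} [Field F] {N g G : F[X]} (hN : Squarefree N) :
    (∀ f, g ∣ f → N ∣ f * G → N ∣ f) ↔
      ∀ p : F[X], p.Monic → Irreducible p → p ∣ N → p ∣ G → p ∣ g := by
  constructor
  · rintro h p - - ⟨r, rfl⟩ hpG
    have hr : r ≠ 0 := right_ne_zero_of_mul hN.ne_zero
    refine (mul_dvd_mul_iff_left hr).mp ?_
    rw [mul_comm r p]
    refine h (r * g) (dvd_mul_left _ _) ?_
    rw [mul_comm p r, mul_assoc]
    exact mul_dvd_mul_left r (hpG.mul_left g)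
  · intro h f hgf hf
    refine hN.dvd_of_forall_irreducible_dvd fun p hpm hp hpN => ?_
    exact (hp.prime.dvd_or_dvd (hpN.trans hf)).elim id fun hpG => (h p hpm hp hpN hpG).trans hgf

lemma exists_frobenius_involution {q : ℕ} (hq : IsPrimePow q) {F : Type*} [Field F] [Fintype F]
    (hF : Fintype.card F = q ^ 2) :
    (q : F) = 0 ∧ ∃ φ : F →+* F, (∀ a, φ a = a ^ q) ∧ ∀ a, φ (φ a) = a := by
  obtain ⟨p, k, hp, hk, rfl⟩ := (isPrimePow_nat_iff _).mp hq
  have : Fact p.Prime := ⟨hp⟩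
  have : CharP F p := charP_of_card_eq_prime_pow (f := k * 2) (by rw [hF, pow_mul])
  refine ⟨by simp [hk.ne'], iterateFrobenius F p k, fun a => iterateFrobenius_def .., fun a => ?_⟩
  rw [iterateFrobenius_def, iterateFrobenius_def, ← pow_mul, ← sq, ← hF, FiniteField.pow_card]

lemma squarefree_X_pow_sub_one {q n : ℕ} {F : Type*} [Field F] (hco : Nat.Coprime n q)
    (hq : (q : F) = 0) : Squarefree (X ^ n - 1 : F[X]) := by
  refine (X_pow_sub_one_separable_iff.mpr fun hn => ?_).squarefree
  obtain ⟨a, b, hab⟩ := Nat.isCoprime_iff_coprime.mpr hco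
  have := congrArg (Int.cast : ℤ → F) hab
  simp [hn, hq] at this

lemma conjPoly_eq_map {F : Type*} [Field F] {φ : F →+* F} {q : ℕ} (hφq : ∀ a, φ a = a ^ q)
    (p : F[X]) : conjPoly q p = p.map φ := by
  simp [conjPoly, Polynomial.map, eval₂_eq_sum, hφq]

lemma recipPoly_dvd_iff {F : Type*} [Field F] {f : F[X]} (hf : f.coeff 0 ≠ 0) (g : F[X]) :
    recipPoly f ∣ g ↔ f.reverse ∣ g :=
  (isUnit_C.mpr (inv_ne_zero hf).isUnit).mul_left_dvd

lemma coeff_zero_ne_zero_of_dvd_X_pow_sub_one {F : Type*} [Field F] {n : ℕ} (hn : 0 < n)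
    {f : F[X]} (hf : f ∣ X ^ n - 1) : f.coeff 0 ≠ 0 := by
  obtain ⟨r, hr⟩ := hf
  intro h
  simpa [mul_coeff_zero, h, coeff_X_pow, hn.ne] using congrArg (coeff · 0) hr

/-- A cyclic code `C = ⟨g⟩` of length `n` over `GF(q²)` is Hermitian LCD iff
for every monic irreducible `p ∣ xⁿ − 1`, `p ∣ g ↔ p̄* ∣ g`. -/
theorem stmt0 {q n : ℕ} (hq : IsPrimePow q) (hn : 0 < n) (hco : Nat.Coprime n q)
    {F : Type*} [Field F] [Fintype F] (hF : Fintype.card F = q ^ 2)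
    (g : Polynomial F) (hg : g.Monic) (hgdvd : g ∣ X ^ n - 1) :
    IsHermitianLCD q ((cyclicCodeOf n g : Submodule F (Fin n → F)) : Set (Fin n → F)) ↔
      ∀ p : Polynomial F, p.Monic → Irreducible p → p ∣ X ^ n - 1 →
        (p ∣ g ↔ recipPoly (conjPoly q p) ∣ g) := by
  obtain ⟨hq0, φ, hφq, hφ⟩ := exists_frobenius_involution hq hF
  have hN : Squarefree (X ^ n - 1 : F[X]) := squarefree_X_pow_sub_one hco hq0
  rw [isHermitianLCD_cyclicCodeOf_iff hn hφq hφ hgdvd]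
  have key : ∀ p : F[X], p ∣ X ^ n - 1 →
      (recipPoly (conjPoly q p) ∣ g ↔ p ∣ conjInv φ n g) := fun p hp => by
    rw [conjPoly_eq_map hφq, recipPoly_dvd_iff
      (coeff_zero_ne_zero_of_dvd_X_pow_sub_one hn (map_dvd_X_pow_sub_one hp)),
      reverse_map_dvd_iff hn hφ hp]
  rw [forall_dvd_mul_imp_dvd_iff hN]
  refine ⟨fun h p hpm hpi hp => ?_, fun h p hpm hpi hp hpg =>
    (h p hpm hpi hp).mpr ((key p hp).mpr hpg)⟩
  rw [key p hp]
  refine ⟨fun hpg => ?_, h p hpm hpi hp⟩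
  rw [← reverse_map_dvd_iff hn hφ hp]
  have hrev : (p.map φ).reverse ∣ X ^ n - 1 :=
    reverse_dvd_X_pow_sub_one (map_dvd_X_pow_sub_one hp)
  refine (hN.squarefree_of_dvd hrev).dvd_of_forall_irreducible_dvd fun r hrm hri hr => ?_
  exact h r hrm hri (hr.trans hrev)
    ((hr.trans (reverse_map_dvd_conjInv hn hp)).trans (map_dvd (conjInv φ n) hpg))
end

section
/- Let q be a prime power, Q = q², and n a positive integer with gcd(n, q) = 1. Then −1 is an odd power of q modulo n (i.e., there exists an integer t ≥ 0 with −1 ≡ q^{2t+1} (mod n)) if and only if every cyclic code of length n over GF(Q) is a Hermitian LCD code. -/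
open Polynomial

/-- The cyclic shift is translation of the index by one. -/
lemma cyclicShift_eq_sub_one {F : Type*} {n : ℕ} [NeZero n] (c : Fin n → F) :
    cyclicShift c = fun i => c (i - 1) := by
  funext i
  refine congrArg c (Fin.ext ?_)
  rw [Fin.sub_def]
  obtain rfl | h := eq_or_ne n 1
  · simp
  · have h1 : 1 < n := by have := NeZero.ne n; omega
    simp [Nat.mod_eq_of_lt h1, add_comm]

/-- Cyclic codes are stable under all translations of the index. -/
lemma IsCyclicCode.translate_mem {F : Type*} [Field F] {n : ℕ} [NeZero n]
    {C : Submodule F (Fin n → F)} (hC : IsCyclicCode C) {c : Fin n → F} (hc : c ∈ C)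
    (k : Fin n) : (fun i => c (i - k)) ∈ C := by
  have key : ∀ m : ℕ, (fun i => c (i - m • (1 : Fin n))) ∈ C := by
    intro m
    induction m with
    | zero => simpa using hc
    | succ m ih =>
      have h := hC _ ih
      rw [cyclicShift_eq_sub_one] at h
      convert h using 3 with i
      rw [succ_nsmul]
      abel
  have hval : ∀ m : ℕ, ((m • (1 : Fin n) : Fin n) : ℕ) = m % n := by
    intro m
    induction m with
    | zero => simp
    | succ m ih => rw [succ_nsmul, Fin.val_add, ih, Fin.val_one', ← Nat.add_mod]
  have hk : (k : ℕ) • (1 : Fin n) = k :=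
    Fin.ext (by rw [hval, Nat.mod_eq_of_lt k.is_lt])
  simpa only [hk] using key k

lemma pow_val_add_of_pow_eq_one {K : Type*} [Monoid K] {n : ℕ} {γ : K} (hγ : γ ^ n = 1)
    (i j : Fin n) : γ ^ ((i + j : Fin n) : ℕ) = γ ^ (i : ℕ) * γ ^ (j : ℕ) := by
  rw [Fin.val_add, ← pow_add, ← pow_mod_orderOf, Nat.mod_mod_of_dvd _ (orderOf_dvd_of_pow_eq_one hγ),
    pow_mod_orderOf]

lemma pow_val_sub_of_pow_eq_one {K : Type*} [Field K] {n : ℕ} [NeZero n] {γ : K}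
    (hγ : γ ^ n = 1) (i j : Fin n) :
    γ ^ ((i - j : Fin n) : ℕ) = γ ^ (i : ℕ) * γ⁻¹ ^ (j : ℕ) := by
  have h0 : γ ≠ 0 := by
    rintro rfl
    simp [NeZero.ne n] at hγ
  have h := pow_val_add_of_pow_eq_one hγ (i - j) j
  rw [sub_add_cancel] at h
  rw [h, inv_pow, mul_assoc, mul_inv_cancel₀ (pow_ne_zero _ h0), mul_one]

/-- The discrete Fourier transform turns cyclic correlation into a product. -/
lemma sum_pow_mul_sum_mul_translate {K : Type*} [Field K] {n : ℕ} [NeZero n] {γ : K}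
    (hγ : γ ^ n = 1) (b e : Fin n → K) :
    ∑ k : Fin n, (∑ i, b i * e (i - k)) * γ ^ (k : ℕ) =
      (∑ i, b i * γ ^ (i : ℕ)) * ∑ j, e j * γ⁻¹ ^ (j : ℕ) := by
  simp_rw [Finset.sum_mul]
  rw [Finset.sum_comm]
  refine Finset.sum_congr rfl fun i _ => ?_
  rw [Finset.mul_sum, ← (Equiv.subLeft i).sum_comp]
  refine Finset.sum_congr rfl fun j _ => ?_
  rw [Equiv.subLeft_apply, sub_sub_cancel, pow_val_sub_of_pow_eq_one hγ]
  ring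

/-- The discrete Fourier transform is injective. -/
lemma eq_zero_of_sum_mul_pow_eq_zero {K : Type*} [Field K] {n : ℕ} {β : K}
    (hβ : IsPrimitiveRoot β n) {v : Fin n → K}
    (h : ∀ γ : K, γ ^ n = 1 → ∑ i, v i * γ ^ (i : ℕ) = 0) : v = 0 := by
  refine Matrix.eq_zero_of_forall_index_sum_mul_pow_eq_zero (f := fun j : Fin n => β ^ (j : ℕ))
    (fun i j hij => Fin.ext (hβ.pow_inj i.2 j.2 hij)) fun j => h _ ?_
  rw [← pow_mul, mul_comm, pow_mul, hβ.pow_eq_one, one_pow]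

/-- A conjugate of an element over a finite field is the image of that element under a power of
the Frobenius automorphism. -/
lemma exists_eq_pow_card_pow_of_aeval_minpoly {F K : Type*} [Field F] [Fintype F] [Field K]
    [Finite K] [Algebra F K] {x y : K} (h : aeval x (minpoly F y) = 0) :
    ∃ a : ℕ, x = y ^ Fintype.card F ^ a := by
  obtain ⟨σ, rfl⟩ := minpoly.exists_algEquiv_of_root' (Algebra.IsAlgebraic.isAlgebraic y) h
  obtain ⟨a, rfl⟩ := (FiniteField.bijective_frobeniusAlgEquivOfAlgebraic_pow F K).2 σ
  refine ⟨a, ?_⟩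
  simp only [AlgEquiv.coe_pow, FiniteField.coe_frobeniusAlgEquivOfAlgebraic_iterate]

/-- The code of all vectors whose discrete Fourier transform is supported on the roots of `m`. -/
def codeOfSpectrum {F : Type*} [Field F] (K : Type*) [Field K] [Algebra F K] (n : ℕ)
    (m : F[X]) : Submodule F (Fin n → F) where
  carrier := {c | ∀ γ : K, γ ^ n = 1 → aeval γ m ≠ 0 →
    ∑ i, algebraMap F K (c i) * γ ^ (i : ℕ) = 0}
  add_mem' := by
    intro a b ha hb γ h1 h2
    simp [add_mul, Finset.sum_add_distrib, ha γ h1 h2, hb γ h1 h2]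
  zero_mem' := by simp
  smul_mem' := by
    intro r c hc γ h1 h2
    simp [mul_assoc, ← Finset.mul_sum, hc γ h1 h2]

lemma isCyclicCode_codeOfSpectrum {F : Type*} [Field F] (K : Type*) [Field K] [Algebra F K]
    (n : ℕ) [NeZero n] (m : F[X]) : IsCyclicCode (codeOfSpectrum K n m) := by
  intro c hc γ h1 h2
  rw [cyclicShift_eq_sub_one, ← Equiv.sum_comp (Equiv.addRight (1 : Fin n))]
  simp only [Equiv.coe_addRight, add_sub_cancel_right, pow_val_add_of_pow_eq_one h1, ← mul_assoc]
  rw [← Finset.sum_mul, hc γ h1 h2, zero_mul]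

lemma exists_ne_zero_mem_codeOfSpectrum {F : Type*} [Field F] {K : Type*} [Field K]
    [Algebra F K] {n : ℕ} (hn : 0 < n) {m : F[X]} (hm : 0 < m.natDegree)
    (hdvd : m ∣ X ^ n - 1) : ∃ c ∈ codeOfSpectrum K n m, c ≠ 0 := by
  obtain ⟨g, hg⟩ := hdvd
  have hX : (X ^ n - 1 : F[X]) ≠ 0 := X_pow_sub_C_ne_zero hn (1 : F)
  have hg0 : g ≠ 0 := by
    rintro rfl
    exact hX (by rw [hg, mul_zero])
  have hdeg : g.natDegree < n := by
    have h := congrArg natDegree hg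
    have hX' : (X ^ n - 1 : F[X]).natDegree = n := natDegree_X_pow_sub_C (r := (1 : F))
    rw [natDegree_mul (ne_zero_of_natDegree_gt hm) hg0, hX'] at h
    omega
  refine ⟨fun i => g.coeff i, fun γ h1 h2 => ?_, fun h => hg0 ?_⟩
  · have h := congrArg (aeval γ) hg
    rw [map_mul] at h
    simp only [map_sub, map_pow, aeval_X, map_one, h1, sub_self] at h
    have h3 := (mul_eq_zero.mp h.symm).resolve_left h2
    rw [aeval_eq_sum_range' hdeg, ← Fin.sum_univ_eq_sum_range
      (fun i => g.coeff i • γ ^ i)] at h3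
    simpa [Algebra.smul_def] using h3
  · rw [← leadingCoeff_eq_zero]
    exact congrFun h ⟨g.natDegree, hdeg⟩

lemma sum_pow_card_pow {F K : Type*} [Field F] [Fintype F] [Field K] [Algebra F K] {q : ℕ}
    (hq : IsPrimePow q) (hF : Fintype.card F = q ^ 2) (m : ℕ) {ι : Type*} (s : Finset ι)
    (f : ι → K) : (∑ i ∈ s, f i) ^ q ^ m = ∑ i ∈ s, f i ^ q ^ m := by
  obtain ⟨p, k, hp, hk, rfl⟩ := hq
  have : Fact p.Prime := ⟨hp.nat_prime⟩
  have hpF : (p : F) = 0 := by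
    have h := FiniteField.cast_card_eq_zero F
    rw [hF] at h
    push_cast at h
    exact eq_zero_of_pow_eq_zero (eq_zero_of_pow_eq_zero h)
  have hpK : (p : K) = 0 := by
    rw [← map_natCast (algebraMap F K), hpF, map_zero]
  have : CharP K p := CharP.ringChar_of_prime_eq_zero hp.nat_prime hpK ▸ ringChar.charP K
  rw [← pow_mul, sum_pow_char_pow]

lemma natCast_ne_zero_of_coprime_card {F : Type*} [Field F] [Fintype F] {n : ℕ}
    (h : n.Coprime (Fintype.card F)) : (n : F) ≠ 0 := by
  intro h0
  have h1 := Nat.isCoprime_iff_coprime.mpr h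
  obtain ⟨u, v, huv⟩ := h1
  have h2 := congrArg (Int.cast : ℤ → F) huv
  push_cast at h2
  rw [h0, FiniteField.cast_card_eq_zero] at h2
  simp at h2

lemma pow_eq_inv_of_natCast_eq_neg_one {K : Type*} [Field K] {n r : ℕ} {γ : K} (hγ : γ ^ n = 1)
    (hr : (r : ZMod n) = -1) : γ ^ r = γ⁻¹ := by
  have h : n ∣ r + 1 := by
    rw [← ZMod.natCast_eq_zero_iff]
    push_cast
    rw [hr]
    ring
  obtain ⟨k, hk⟩ := h
  apply eq_inv_of_mul_eq_one_left
  rw [← pow_succ, hk, pow_mul, hγ, one_pow]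

/-- If an even power of a unit `q` is minus an odd power, then `-1` is an odd power of `q`. -/
lemma exists_odd_pow_eq_neg_one {n q a b : ℕ} (hn : 0 < n) (hco : q.Coprime n)
    (h : (q : ZMod n) ^ (2 * a + 1) = -(q : ZMod n) ^ (2 * b)) :
    ∃ t : ℕ, (q : ZMod n) ^ (2 * t + 1) = -1 := by
  have hM : (q : ZMod n) ^ n.totient = 1 := by
    have h := congrArg Units.val (ZMod.pow_totient (ZMod.unitOfCoprime q hco))
    rwa [Units.val_pow_eq_pow_val, ZMod.coe_unitOfCoprime, Units.val_one] at h
  obtain ⟨M, hM'⟩ : ∃ M, n.totient = M + 1 :=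
    ⟨_, (Nat.succ_pred_eq_of_pos (Nat.totient_pos.mpr hn)).symm⟩
  refine ⟨a + b * M, ?_⟩
  calc (q : ZMod n) ^ (2 * (a + b * M) + 1)
      = (q : ZMod n) ^ (2 * a + 1) * (q : ZMod n) ^ (2 * b * M) := by ring
    _ = -((q : ZMod n) ^ (M + 1)) ^ (2 * b) := by rw [h]; ring
    _ = -1 := by rw [← hM', hM, one_pow]

lemma pow_odd_pow_eq_pow {F : Type*} [Field F] [Fintype F] {q : ℕ}
    (hF : Fintype.card F = q ^ 2) (x : F) (t : ℕ) : x ^ q ^ (2 * t + 1) = x ^ q := by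
  rw [pow_succ, pow_mul, pow_mul q, ← hF, FiniteField.pow_card_pow]

/-- `−1` is an odd power of `q` modulo `n` iff every cyclic code of
length `n` over `GF(q²)` is a Hermitian LCD code. -/
theorem stmt3 {q n : ℕ} (hq : IsPrimePow q) (hn : 0 < n) (hco : Nat.Coprime n q)
    {F : Type*} [Field F] [Fintype F] (hF : Fintype.card F = q ^ 2) :
    (∃ t : ℕ, ((q : ZMod n)) ^ (2 * t + 1) = -1) ↔
      ∀ C : Submodule F (Fin n → F), IsCyclicCode C →
        IsHermitianLCD q (C : Set (Fin n → F)) := by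
  have : NeZero n := ⟨hn.ne'⟩
  have hnF : (n : F) ≠ 0 := natCast_ne_zero_of_coprime_card (hF ▸ hco.pow_right 2)
  have : NeZero (n : F) := ⟨hnF⟩
  let K := CyclotomicField n F
  have : FiniteDimensional F K := IsCyclotomicExtension.finiteDimensional {n} F K
  have : Finite K := Module.finite_of_finite F
  obtain ⟨β, hβ⟩ : ∃ β : K, IsPrimitiveRoot β n :=
    ⟨_, IsCyclotomicExtension.zeta_spec n F K⟩
  have hinj := (algebraMap F K).injective
  constructor
  · rintro ⟨t, ht⟩ C hC
    refine Set.Subset.antisymm ?_ ?_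
    · rintro c ⟨hcC, hc⟩
      have hcK : (fun i => algebraMap F K (c i)) = 0 := by
        refine eq_zero_of_sum_mul_pow_eq_zero hβ fun γ hγ => ?_
        have h := sum_pow_mul_sum_mul_translate hγ (fun i => algebraMap F K (c i))
          (fun i => algebraMap F K (c i) ^ q)
        have hzero : ∀ k : Fin n,
            ∑ i, algebraMap F K (c i) * algebraMap F K (c (i - k)) ^ q = 0 := by
          intro k
          have := congrArg (algebraMap F K) (hc _ (hC.translate_mem hcC k))
          simpa using this
        simp only [hzero, zero_mul, Finset.sum_const_zero] at h
        have hconj : ∑ j, algebraMap F K (c j) ^ q * γ⁻¹ ^ (j : ℕ) =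
            (∑ j, algebraMap F K (c j) * γ ^ (j : ℕ)) ^ q ^ (2 * t + 1) := by
          rw [sum_pow_card_pow hq hF]
          refine Finset.sum_congr rfl fun j _ => ?_
          rw [mul_pow, ← map_pow, ← map_pow, pow_odd_pow_eq_pow hF, pow_right_comm,
            pow_eq_inv_of_natCast_eq_neg_one hγ (by push_cast; exact ht)]
        rw [hconj, ← pow_succ'] at h
        exact eq_zero_of_pow_eq_zero h.symm
      funext i
      exact hinj (by simpa using congrFun hcK i)
    · rintro _ rfl
      exact ⟨C.zero_mem, fun c _ => by simp⟩
  · intro hall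
    by_contra hno
    have hβint : IsIntegral F β := Algebra.IsIntegral.isIntegral β
    obtain ⟨c, hcC, hc0⟩ := exists_ne_zero_mem_codeOfSpectrum (K := K) hn
      (minpoly.natDegree_pos hβint) (minpoly.dvd F β (by simp [hβ.pow_eq_one]))
    have hcyc := isCyclicCode_codeOfSpectrum K n (minpoly F β)
    refine hc0 ((hall _ hcyc).subset ⟨hcC, fun d hd => ?_⟩)
    have hcorr : (fun k : Fin n =>
        ∑ i, algebraMap F K (c i) * algebraMap F K (d (i - k)) ^ q) = 0 := by
      refine eq_zero_of_sum_mul_pow_eq_zero hβ fun γ hγ => ?_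
      rw [sum_pow_mul_sum_mul_translate hγ (fun i => algebraMap F K (c i))
        (fun i => algebraMap F K (d i) ^ q), mul_eq_zero, or_iff_not_imp_left]
      intro hne
      have hroot : aeval γ (minpoly F β) = 0 := not_imp_comm.mp (hcC γ hγ) hne
      have hconj : (∑ j, algebraMap F K (d j) ^ q * γ⁻¹ ^ (j : ℕ)) ^ q =
          ∑ j, algebraMap F K (d j) * (γ⁻¹ ^ q) ^ (j : ℕ) := by
        have h := sum_pow_card_pow hq hF 1 Finset.univ
          (fun j : Fin n => algebraMap F K (d j) ^ q * γ⁻¹ ^ (j : ℕ))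
        rw [pow_one] at h
        rw [h]
        refine Finset.sum_congr rfl fun j _ => ?_
        rw [mul_pow, ← pow_mul, ← sq, ← hF, ← map_pow, FiniteField.pow_card, pow_right_comm]
      have hroot' : aeval (γ⁻¹ ^ q) (minpoly F β) ≠ 0 := by
        intro h
        obtain ⟨a, ha⟩ := exists_eq_pow_card_pow_of_aeval_minpoly hroot
        obtain ⟨b, hb⟩ := exists_eq_pow_card_pow_of_aeval_minpoly h
        rw [hF, ← pow_mul] at ha hb
        refine hno (exists_odd_pow_eq_neg_one (a := a) (b := b) hn hco.symm ?_)
        have hγ0 : γ ≠ 0 := by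
          rintro rfl
          simp [hn.ne'] at hγ
        have h1 : β ^ (q ^ (2 * a + 1) + q ^ (2 * b)) = 1 := by
          rw [pow_add, ← hb, pow_succ q, pow_mul, ← ha, ← mul_pow, mul_inv_cancel₀ hγ0, one_pow]
        have h2 := (ZMod.natCast_eq_zero_iff _ _).mpr (hβ.dvd_of_pow_eq_one _ h1)
        push_cast at h2
        exact eq_neg_of_add_eq_zero_left h2
      have h := hd (γ⁻¹ ^ q) (by rw [pow_right_comm, inv_pow, hγ, inv_one, one_pow]) hroot'
      exact eq_zero_of_pow_eq_zero (hconj.trans h)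
    have h := congrFun hcorr 0
    simp only [sub_zero, Pi.zero_apply] at h
    apply hinj
    simpa using h
end

section
/- Let q be a prime power, Q = q², t ≥ 1 an integer, and n = q^{2t+1} + 1. Then the multiplicative order of Q modulo n equals 2t+1, and for every integer i with 1 ≤ i ≤ q, the integer i is the coset leader of the Q-cyclotomic coset C_i modulo n and |C_i| = 2t+1. -/
open Polynomial

theorem sq_pow_modEq_one (q m : ℕ) : (q ^ 2) ^ m ≡ 1 [MOD q ^ m + 1] := by
  have h : (q ^ 2) ^ m + q ^ m = q ^ m * (q ^ m + 1) := by ring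
  have h₁ : (q ^ 2) ^ m + q ^ m ≡ 1 + q ^ m [MOD q ^ m + 1] := by
    rw [h, add_comm 1]
    exact ((Nat.modEq_zero_iff_dvd.2 (dvd_mul_left _ _)).trans
      (Nat.modEq_zero_iff_dvd.2 dvd_rfl).symm)
  exact Nat.ModEq.add_right_cancel' _ h₁

theorem sq_pow_modEq_sq_pow_mod (q m j : ℕ) :
    (q ^ 2) ^ j ≡ (q ^ 2) ^ (j % m) [MOD q ^ m + 1] := by
  conv_lhs => rw [← Nat.mod_add_div j m, pow_add, pow_mul]
  simpa using ((sq_pow_modEq_one q m).pow (j / m)).mul_left ((q ^ 2) ^ (j % m))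

theorem lt_mul_sq_pow_mod {q t i j : ℕ} (hq : 2 ≤ q) (hi : 1 ≤ i) (hiq : i ≤ q)
    (hj : 0 < j) (hjm : j < 2 * t + 1) :
    i < i * (q ^ 2) ^ j % (q ^ (2 * t + 1) + 1) := by
  have hbound (e : ℕ) : i * q ^ e ≤ q ^ (e + 1) := by
    rw [pow_succ, mul_comm]
    exact Nat.mul_le_mul_left _ hiq
  rw [← pow_mul]
  rcases le_or_gt j t with hjt | hjt
  · have h₁ : i * q ^ (2 * j) ≤ q ^ (2 * t + 1) :=
      (hbound _).trans (Nat.pow_le_pow_right (by omega) (by omega))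
    rw [Nat.mod_eq_of_lt (by omega)]
    exact lt_mul_right (by omega) (Nat.one_lt_pow (by omega) (by omega))
  · obtain ⟨e, he⟩ : ∃ e, 2 * j = 2 * t + 1 + e := ⟨2 * j - (2 * t + 1), by omega⟩
    have h₁ : i * q ^ e ≤ q ^ (2 * t) :=
      (hbound e).trans (Nat.pow_le_pow_right (by omega) (by omega))
    have h₂ : q ^ (2 * t) * 2 ≤ q ^ (2 * t + 1) := by
      rw [pow_succ]
      exact Nat.mul_le_mul_left _ hq
    have h₃ : q ≤ q ^ (2 * t) := Nat.le_self_pow (by omega) q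
    have hpos : 0 < i * q ^ e := Nat.mul_pos hi (Nat.pow_pos (by omega))
    have hmod : i * q ^ (2 * j) ≡ q ^ (2 * t + 1) + 1 - i * q ^ e [MOD q ^ (2 * t + 1) + 1] := by
      refine Nat.ModEq.add_right_cancel' (i * q ^ e) ?_
      rw [Nat.sub_add_cancel (by omega)]
      have h : i * q ^ (2 * j) + i * q ^ e = i * q ^ e * (q ^ (2 * t + 1) + 1) := by
        rw [he]
        ring
      rw [h]
      exact (Nat.modEq_zero_iff_dvd.2 (dvd_mul_left _ _)).trans
        (Nat.modEq_zero_iff_dvd.2 dvd_rfl).symm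
    rw [hmod, Nat.mod_eq_of_lt (by omega)]
    omega

theorem cycCoset_eq_image (q m i : ℕ) (hm : 0 < m) :
    cycCoset (q ^ 2) (q ^ m + 1) (i : ℤ) =
      (fun j => i * (q ^ 2) ^ j % (q ^ m + 1)) '' (Finset.range m : Set ℕ) := by
  ext x
  simp only [cycCoset, Set.mem_ofPred_eq, Set.mem_image, Finset.coe_range, Set.mem_Iio]
  constructor
  · rintro ⟨hx, j, hj⟩
    refine ⟨j % m, Nat.mod_lt _ hm, ?_⟩
    have hj' : x ≡ i * (q ^ 2) ^ j [MOD q ^ m + 1] := by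
      rw [← Int.natCast_modEq_iff]
      exact_mod_cast hj
    rw [← Nat.mod_eq_of_lt hx]
    exact (hj'.trans ((sq_pow_modEq_sq_pow_mod q m j).mul_left i)).symm
  · rintro ⟨j, -, rfl⟩
    refine ⟨Nat.mod_lt _ (by omega), j, ?_⟩
    have h := Int.natCast_modEq_iff.2 (Nat.mod_modEq (i * (q ^ 2) ^ j) (q ^ m + 1))
    exact_mod_cast h

theorem mul_sq_pow_mod_injOn {q t i : ℕ} (hq : 2 ≤ q) (hi : 1 ≤ i) (hiq : i ≤ q) :
    Set.InjOn (fun j => i * (q ^ 2) ^ j % (q ^ (2 * t + 1) + 1))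
      (Finset.range (2 * t + 1) : Set ℕ) := by
  have hcop (a : ℕ) : (q ^ (2 * t + 1) + 1).gcd ((q ^ 2) ^ a) = 1 := by
    have h : Nat.Coprime (q ^ (2 * t + 1) + 1) q := by
      rw [pow_succ, Nat.coprime_mul_right_add_left]
      exact Nat.coprime_one_left q
    exact (h.pow_right 2).pow_right a
  have key {a b : ℕ} (hab : a < b) (hb : b < 2 * t + 1) :
      ¬ i * (q ^ 2) ^ a ≡ i * (q ^ 2) ^ b [MOD q ^ (2 * t + 1) + 1] := by
    intro h
    have h' : i * (q ^ 2) ^ (b - a) ≡ i [MOD q ^ (2 * t + 1) + 1] := by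
      refine Nat.ModEq.cancel_right_of_coprime (hcop a) ?_
      rw [mul_assoc, ← pow_add, Nat.sub_add_cancel hab.le]
      exact h.symm
    have hlt := lt_mul_sq_pow_mod (t := t) hq hi hiq (j := b - a) (by omega) (by omega)
    rw [h'] at hlt
    exact (Nat.mod_le i _).not_gt hlt
  intro a ha b hb hab
  simp only [Finset.coe_range, Set.mem_Iio] at ha hb
  rcases lt_trichotomy a b with h | h | h
  · exact (key h hb hab).elim
  · exact h
  · exact (key h ha hab.symm).elim

/-- For `n = q^{2t+1} + 1` and `Q = q²`, the multiplicative order of `Q`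
modulo `n` is `2t+1`, and every `i` with `1 ≤ i ≤ q` is the coset leader of the
`Q`-cyclotomic coset `C_i` modulo `n`, with `|C_i| = 2t+1`. -/
theorem stmt5 {q t : ℕ} (hq : IsPrimePow q) (ht : 1 ≤ t) :
    orderOf ((q ^ 2 : ℕ) : ZMod (q ^ (2 * t + 1) + 1)) = 2 * t + 1 ∧
    ∀ i : ℕ, 1 ≤ i → i ≤ q →
      sInf (cycCoset (q ^ 2) (q ^ (2 * t + 1) + 1) (i : ℤ)) = i ∧
      (cycCoset (q ^ 2) (q ^ (2 * t + 1) + 1) (i : ℤ)).ncard = 2 * t + 1 := by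
  have hq2 : 2 ≤ q := hq.two_le
  refine ⟨?_, fun i hi hiq => ⟨?_, ?_⟩⟩
  · rw [orderOf_eq_iff (by omega)]
    refine ⟨?_, fun j hj hj0 h => ?_⟩
    · have h := (ZMod.natCast_eq_natCast_iff _ _ _).2 (sq_pow_modEq_one q (2 * t + 1))
      simpa using h
    · have h' : 1 * (q ^ 2) ^ j ≡ 1 [MOD q ^ (2 * t + 1) + 1] := by
        rw [← ZMod.natCast_eq_natCast_iff]
        simpa using h
      have hlt := lt_mul_sq_pow_mod (t := t) hq2 le_rfl (by omega) hj0 hj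
      rw [h'] at hlt
      exact (Nat.mod_le 1 _).not_gt hlt
  · rw [cycCoset_eq_image q _ i (by omega)]
    have hi_mod : i % (q ^ (2 * t + 1) + 1) = i :=
      Nat.mod_eq_of_lt (Nat.lt_succ_of_le (hiq.trans (Nat.le_self_pow (by omega) q)))
    refine IsLeast.csInf_eq ⟨⟨0, by simp, by simpa using hi_mod⟩, ?_⟩
    rintro _ ⟨j, hj, rfl⟩
    rcases Nat.eq_zero_or_pos j with rfl | hj0
    · simpa using hi_mod.ge
    · exact (lt_mul_sq_pow_mod hq2 hi hiq hj0 (by simpa using hj)).le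
  · rw [cycCoset_eq_image q _ i (by omega), (mul_sq_pow_mod_injOn hq2 hi hiq).ncard_image,
      Set.ncard_coe_finset, Finset.card_range]
end

section
/- Let q be a prime power, Q = q², m a positive integer, n = Q^m − 1, e a divisor of q + 1, and n̂ = n/e. Then, for all integers i and j (indices of cosets taken modulo n): (1) |C_{n̂+i}| = |C_{n̂−qi}| = |C_i|; (2) C_{n̂+i} = C_{n̂+j} if and only if C_i = C_j; (3) C_{n̂−qi} = C_{n̂−qj} if and only if C_i = C_j; (4) C_{n̂+Qi} = C_{n̂+i} and C_{n̂−qQi} = C_{n̂−qi}. -/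
open Polynomial

/-- The cyclotomic coset is the set of least residues of the orbit of `s` in `ZMod n`. -/
theorem cycCoset_eq_val_image (Q n : ℕ) [NeZero n] (s : ℤ) :
    cycCoset Q n s = ZMod.val '' Set.range fun k : ℕ => (s : ZMod n) * (Q : ZMod n) ^ k := by
  have h (x k : ℕ) : (x : ℤ) ≡ s * (Q : ℤ) ^ k [ZMOD n] ↔
      (s : ZMod n) * (Q : ZMod n) ^ k = (x : ZMod n) := by
    rw [← ZMod.intCast_eq_intCast_iff, eq_comm]
    push_cast
    rfl
  ext x
  simp only [cycCoset, Set.mem_ofPred_eq, h, Set.mem_image, Set.mem_range]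
  constructor
  · rintro ⟨hx, k, hk⟩
    exact ⟨x, ⟨k, hk⟩, ZMod.val_cast_of_lt hx⟩
  · rintro ⟨z, ⟨k, hk⟩, rfl⟩
    exact ⟨ZMod.val_lt z, k, by rw [hk, ZMod.natCast_zmod_val]⟩

theorem cycCoset_eq_iff (Q n : ℕ) [NeZero n] (s t : ℤ) :
    cycCoset Q n s = cycCoset Q n t ↔
      (Set.range fun k : ℕ => (s : ZMod n) * (Q : ZMod n) ^ k) =
        Set.range fun k : ℕ => (t : ZMod n) * (Q : ZMod n) ^ k := by
  rw [cycCoset_eq_val_image, cycCoset_eq_val_image]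
  exact (ZMod.val_injective n).image_injective.eq_iff

theorem ncard_cycCoset (Q n : ℕ) [NeZero n] (s : ℤ) :
    (cycCoset Q n s).ncard =
      (Set.range fun k : ℕ => (s : ZMod n) * (Q : ZMod n) ^ k).ncard := by
  rw [cycCoset_eq_val_image, Set.ncard_image_of_injective _ (ZMod.val_injective n)]

/-- An affine map whose constant term is fixed by multiplication by `r` commutes with
taking orbits under multiplication by `r`. -/
theorem range_affine_mul_pow {R : Type*} [CommRing R] {c r : R} (hc : c * r = c) (a s : R) :
    (Set.range fun k : ℕ => (c + a * s) * r ^ k) =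
      (fun z => c + a * z) '' Set.range fun k : ℕ => s * r ^ k := by
  have hpow (k : ℕ) : c * r ^ k = c := by
    induction k with
    | zero => simp
    | succ k ih => rw [pow_succ, ← mul_assoc, ih, hc]
  rw [← Set.range_comp]
  congr 1
  funext k
  simp only [Function.comp_apply, add_mul, hpow, mul_assoc]

theorem injective_affine {R : Type*} [CommRing R] {a : R} (ha : IsUnit a) (c : R) :
    Function.Injective fun z => c + a * z :=
  (add_right_injective c).comp ha.mul_right_injective

theorem ncard_cycCoset_affine {Q n : ℕ} [NeZero n] {c a : ℤ}
    (hc : (c : ZMod n) * (Q : ZMod n) = c) (ha : IsUnit (a : ZMod n)) (s : ℤ) :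
    (cycCoset Q n (c + a * s)).ncard = (cycCoset Q n s).ncard := by
  rw [ncard_cycCoset, ncard_cycCoset]
  push_cast
  rw [range_affine_mul_pow hc, Set.ncard_image_of_injective _ (injective_affine ha _)]

theorem cycCoset_affine_eq_iff {Q n : ℕ} [NeZero n] {c a : ℤ}
    (hc : (c : ZMod n) * (Q : ZMod n) = c) (ha : IsUnit (a : ZMod n)) (s t : ℤ) :
    cycCoset Q n (c + a * s) = cycCoset Q n (c + a * t) ↔ cycCoset Q n s = cycCoset Q n t := by
  rw [cycCoset_eq_iff, cycCoset_eq_iff]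
  push_cast
  rw [range_affine_mul_pow hc, range_affine_mul_pow hc]
  exact (injective_affine ha _).image_injective.eq_iff

theorem cycCoset_mul_self {Q n m : ℕ} [NeZero n] (hm : 0 < m) (hQ : (Q : ZMod n) ^ m = 1)
    (s : ℤ) : cycCoset Q n (Q * s) = cycCoset Q n s := by
  obtain ⟨m, rfl⟩ := Nat.exists_eq_add_of_lt hm
  rw [cycCoset_eq_iff]
  push_cast
  apply Set.Subset.antisymm
  · rintro _ ⟨k, rfl⟩
    exact ⟨k + 1, by ring⟩
  · rintro _ ⟨k, rfl⟩
    refine ⟨k + m, ?_⟩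
    calc (Q : ZMod n) * s * (Q : ZMod n) ^ (k + m)
        = s * (Q : ZMod n) ^ k * (Q : ZMod n) ^ (0 + m + 1) := by ring
      _ = s * (Q : ZMod n) ^ k := by rw [hQ, mul_one]

/-- Properties of `Q`-cyclotomic cosets modulo `n = Qᵐ − 1` relative to
`n̂ = n/e` where `e ∣ q + 1`. -/
theorem stmt7 {q Q m e n nh : ℕ} (hq : IsPrimePow q) (hQ : Q = q ^ 2) (hm : 0 < m)
    (he : e ∣ q + 1) (he0 : 0 < e) (hn : n = Q ^ m - 1) (hnh : nh = n / e)
    (i j : ℤ) :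
    ((cycCoset Q n ((nh : ℤ) + i)).ncard = (cycCoset Q n i).ncard ∧
      (cycCoset Q n ((nh : ℤ) - q * i)).ncard = (cycCoset Q n i).ncard) ∧
    (cycCoset Q n ((nh : ℤ) + i) = cycCoset Q n ((nh : ℤ) + j) ↔
      cycCoset Q n i = cycCoset Q n j) ∧
    (cycCoset Q n ((nh : ℤ) - q * i) = cycCoset Q n ((nh : ℤ) - q * j) ↔
      cycCoset Q n i = cycCoset Q n j) ∧
    (cycCoset Q n ((nh : ℤ) + Q * i) = cycCoset Q n ((nh : ℤ) + i) ∧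
      cycCoset Q n ((nh : ℤ) - q * (Q * i)) = cycCoset Q n ((nh : ℤ) - q * i)) := by
  have hq2 : 2 ≤ q := hq.two_le
  have hQm : 1 < Q ^ m := Nat.one_lt_pow hm.ne' (by rw [hQ]; nlinarith)
  have : NeZero n := ⟨by omega⟩
  have hpow : (Q : ZMod n) ^ m = 1 := by
    have h : Q ^ m = n + 1 := by omega
    exact_mod_cast (congrArg (Nat.cast : ℕ → ZMod n) h).trans (by simp)
  have heQ : (e : ℤ) ∣ (Q : ℤ) - 1 := by
    have h : (e : ℤ) ∣ (q : ℤ) + 1 := by exact_mod_cast he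
    rw [hQ]
    push_cast
    exact h.trans ⟨q - 1, by ring⟩
  have hnc : (n : ℤ) = (Q : ℤ) ^ m - 1 := by
    rw [hn]
    push_cast [Nat.cast_sub hQm.le]
    rfl
  have hen : e ∣ n := by
    have h : (Q : ℤ) - 1 ∣ n := hnc ▸ sub_one_dvd_pow_sub_one _ _
    exact_mod_cast heQ.trans h
  have hnhe : (nh : ℤ) * e = n := by
    rw [hnh]
    exact_mod_cast Nat.div_mul_cancel hen
  have hc : ((nh : ℤ) : ZMod n) * (Q : ZMod n) = (nh : ℤ) := by
    obtain ⟨d, hd⟩ := heQ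
    have h : (nh : ℤ) * Q = nh + n * d := by
      rw [← hnhe]
      linear_combination (nh : ℤ) * hd
    have h' := congrArg (Int.cast : ℤ → ZMod n) h
    push_cast at h' ⊢
    simpa using h'
  have hqu : IsUnit (((-q : ℤ)) : ZMod n) := by
    have h : IsUnit (q : ZMod n) := by
      refine IsUnit.of_pow_eq_one (n := 2 * m) ?_ (by omega)
      rw [pow_mul, ← hpow, hQ]
      push_cast
      rfl
    push_cast
    exact h.neg
  have h1 : IsUnit ((1 : ℤ) : ZMod n) := by simp
  have ncard1 := ncard_cycCoset_affine hc h1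
  have iff1 := cycCoset_affine_eq_iff hc h1
  have ncardq := ncard_cycCoset_affine hc hqu
  have iffq := cycCoset_affine_eq_iff hc hqu
  simp only [one_mul] at ncard1 iff1
  simp only [neg_mul, ← sub_eq_add_neg] at ncardq iffq
  have hmul := cycCoset_mul_self hm hpow i
  exact ⟨⟨ncard1 i, ncardq i⟩, iff1 i j, iffq i j, (iff1 _ _).2 hmul, (iffq _ _).2 hmul⟩
end

section
/- Let q be a prime power, Q = q², m ≥ 2 an integer, m̄ = ⌈m/2⌉, n = Q^m − 1, e a divisor of q + 1, and n̂ = n/e. For any integer δ with 2 ≤ δ ≤ Q^m̄ + 1, define J⁺(δ) = ∪_{i=1}^{δ−1} C_{n̂+i} and J⁻(δ) = ∪_{i=1}^{δ−1} C_{n̂−qi}. Then |J⁺(δ)| = |J⁻(δ)| = (δ − 1 − ⌊(δ−1)/Q⌋) m. -/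
open Polynomial

/-- If `i * Q ^ t` is still at most `Q ^ m - 1`, a congruence with `j` forces `Q ∣ j`. -/
theorem dvd_of_mul_pow_modEq {Q m k i j t : ℕ} (hQ : 2 ≤ Q) (hk : k < m)
    (hi0 : 0 < i) (hj0 : 0 < j) (hi : i < Q ^ k) (hj : j < Q ^ k) (ht0 : 0 < t) (ht : t + k ≤ m)
    (h : i * Q ^ t ≡ j [MOD Q ^ m - 1]) : Q ∣ j := by
  have hQt : 0 < Q ^ t := by positivity
  have h1 : i * Q ^ t < Q ^ m := calc
    i * Q ^ t < Q ^ k * Q ^ t := Nat.mul_lt_mul_of_pos_right hi hQt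
    _ = Q ^ (t + k) := by ring
    _ ≤ Q ^ m := Nat.pow_le_pow_right (by omega) ht
  have h2 : Q ^ k < Q ^ m := Nat.pow_lt_pow_right (by omega) hk
  have h3 : 0 < i * Q ^ t := by positivity
  have h4 : i * Q ^ t = j := by
    obtain ⟨z, hz⟩ := Nat.modEq_iff_dvd.mp h
    have hz0 : (j : ℤ) - (i * Q ^ t : ℕ) = 0 := by
      apply Int.eq_zero_of_abs_lt_dvd ⟨z, hz⟩
      rw [abs_lt]
      omega
    omega
  rw [← h4]
  exact Dvd.dvd.mul_left (dvd_pow_self Q ht0.ne') i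

/-- Below `Q ^ k` with `2 k ≤ m + 1`, distinct non-multiples of `Q` lie in distinct
`Q`-cyclotomic cosets modulo `Q ^ m - 1`, each of full size. -/
theorem eq_zero_of_mul_pow_modEq {Q m k i j t : ℕ} (hQ : 2 ≤ Q) (hk : k < m)
    (hkm : 2 * k ≤ m + 1) (hi : i < Q ^ k) (hj : j < Q ^ k) (hiQ : ¬ Q ∣ i) (hjQ : ¬ Q ∣ j)
    (ht : t < m) (h : i * Q ^ t ≡ j [MOD Q ^ m - 1]) : t = 0 := by
  have hi0 : 0 < i := Nat.pos_of_ne_zero (by rintro rfl; simp at hiQ)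
  have hj0 : 0 < j := Nat.pos_of_ne_zero (by rintro rfl; simp at hjQ)
  by_contra ht0
  rcases le_or_gt (t + k) m with hle | hgt
  · exact hjQ (dvd_of_mul_pow_modEq hQ hk hi0 hj0 hi hj (by omega) hle h)
  · have hQm : Q ^ m ≡ 1 [MOD Q ^ m - 1] :=
      ((Nat.modEq_iff_dvd' (Nat.one_le_pow _ _ (by omega))).mpr dvd_rfl).symm
    refine hiQ (dvd_of_mul_pow_modEq (t := m - t) hQ hk hj0 hi0 hj hi (by omega) (by omega) ?_)
    calc j * Q ^ (m - t) ≡ i * Q ^ t * Q ^ (m - t) [MOD Q ^ m - 1] := (h.mul_right _).symm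
      _ = i * Q ^ m := by rw [mul_assoc, ← pow_add, Nat.add_sub_cancel' ht.le]
      _ ≡ i * 1 [MOD Q ^ m - 1] := hQm.mul_left _
      _ = i := mul_one i

theorem ZMod.natCast_pow_eq_one_of_pred {Q m : ℕ} (hQ : 0 < Q) :
    (Q : ZMod (Q ^ m - 1)) ^ m = 1 := by
  have h := (ZMod.natCast_eq_natCast_iff (Q ^ m) 1 (Q ^ m - 1)).mpr
    ((Nat.modEq_iff_dvd' (Nat.one_le_pow _ _ hQ)).mpr dvd_rfl).symm
  simpa using h

theorem injOn_mul_pow {Q m k : ℕ} (hQ : 2 ≤ Q) (hk : k < m) (hkm : 2 * k ≤ m + 1) :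
    Set.InjOn (fun p : ℕ × ℕ => (p.1 : ZMod (Q ^ m - 1)) * (Q : ZMod (Q ^ m - 1)) ^ p.2)
      {p | p.1 < Q ^ k ∧ ¬ Q ∣ p.1 ∧ p.2 < m} := by
  have hQm : (Q : ZMod (Q ^ m - 1)) ^ m = 1 := ZMod.natCast_pow_eq_one_of_pred (by omega)
  have key : ∀ i j s t : ℕ, i < Q ^ k → j < Q ^ k → ¬ Q ∣ i → ¬ Q ∣ j → t < m → s ≤ t →
      (i : ZMod (Q ^ m - 1)) * (Q : ZMod (Q ^ m - 1)) ^ t = j * (Q : ZMod (Q ^ m - 1)) ^ s →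
      i = j ∧ t = s := by
    intro i j s t hi hj hiQ hjQ ht hst h
    have hu : IsUnit ((Q : ZMod (Q ^ m - 1)) ^ s) :=
      (IsUnit.of_pow_eq_one hQm (by omega)).pow s
    obtain ⟨d, rfl⟩ := Nat.exists_eq_add_of_le hst
    have h' : (i : ZMod (Q ^ m - 1)) * (Q : ZMod (Q ^ m - 1)) ^ d = j := by
      apply hu.mul_right_cancel
      rw [← h]
      ring
    have h'' : i * Q ^ d ≡ j [MOD Q ^ m - 1] := by
      rw [← ZMod.natCast_eq_natCast_iff]
      push_cast
      exact h'
    have hd : d = 0 := eq_zero_of_mul_pow_modEq hQ hk hkm hi hj hiQ hjQ (by omega) h''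
    subst hd
    have hlt : Q ^ k < Q ^ m := Nat.pow_lt_pow_right (by omega) hk
    refine ⟨?_, by omega⟩
    rw [pow_zero, mul_one] at h''
    exact Nat.ModEq.eq_of_lt_of_lt h'' (by omega) (by omega)
  rintro ⟨i, t⟩ ⟨hi, hiQ, ht⟩ ⟨j, s⟩ ⟨hj, hjQ, hs⟩ h
  rcases le_total s t with hst | hst
  · obtain ⟨h1, h2⟩ := key i j s t hi hj hiQ hjQ ht hst h
    rw [h1, h2]
  · obtain ⟨h1, h2⟩ := key j i t s hj hi hjQ hiQ hs hst h.symm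
    rw [h1, h2]

theorem card_filter_not_dvd (K Q : ℕ) :
    ((Finset.Icc 1 K).filter (fun i => ¬ Q ∣ i)).card = K - K / Q := by
  have h1 := Finset.card_filter_add_card_filter_not (s := Finset.Icc 1 K) (fun i => Q ∣ i)
  have h2 : ((Finset.Icc 1 K).filter (fun i => Q ∣ i)).card = K / Q :=
    Nat.Ioc_filter_dvd_card_eq_div K Q
  rw [h2, Nat.card_Icc] at h1
  omega

/-- Size of a union of cosets `C_{a + c i}`, `1 ≤ i ≤ K`, where `a` is fixed by multiplication
by `Q` and `c` is a unit modulo `Q ^ m - 1`. -/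
theorem ncard_iUnion_cycCoset {Q m k K : ℕ} {a c : ℤ} (hQ : 2 ≤ Q) (hk0 : 0 < k) (hk : k < m)
    (hkm : 2 * k ≤ m + 1) (hK : K ≤ Q ^ k)
    (ha : (a : ZMod (Q ^ m - 1)) * Q = a) (hc : IsUnit (c : ZMod (Q ^ m - 1))) :
    (⋃ i ∈ Finset.Icc 1 K, cycCoset Q (Q ^ m - 1) (a + c * i)).ncard = (K - K / Q) * m := by
  have hlt : Q ^ k < Q ^ m := Nat.pow_lt_pow_right (by omega) hk
  have hpos : 0 < Q ^ k := by positivity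
  have : NeZero (Q ^ m - 1) := ⟨by omega⟩
  have hQm : (Q : ZMod (Q ^ m - 1)) ^ m = 1 := ZMod.natCast_pow_eq_one_of_pred (by omega)
  have haj : ∀ j : ℕ, (a : ZMod (Q ^ m - 1)) * (Q : ZMod (Q ^ m - 1)) ^ j = a := by
    intro j
    induction j with
    | zero => simp
    | succ j ih => rw [pow_succ, ← mul_assoc, ih, ha]
  set S := (Finset.Icc 1 K).filter (fun i => ¬ Q ∣ i) with hS
  let f : ℕ × ℕ → ℕ := fun p =>
    ((a : ZMod (Q ^ m - 1)) + c * ((p.1 : ZMod (Q ^ m - 1)) * (Q : ZMod (Q ^ m - 1)) ^ p.2)).val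
  have hU : (⋃ i ∈ Finset.Icc 1 K, cycCoset Q (Q ^ m - 1) (a + c * i))
      = f '' (S ×ˢ Finset.range m : Finset (ℕ × ℕ)) := by
    ext x
    simp only [Set.mem_iUnion, cycCoset, Set.mem_ofPred_eq, Set.mem_image, Finset.mem_coe,
      Finset.mem_product, Finset.mem_range, Prod.exists, exists_prop]
    constructor
    · rintro ⟨i, hi, hx, j, hj⟩
      rw [Finset.mem_Icc] at hi
      obtain ⟨s, i', hi', rfl⟩ := Nat.exists_eq_pow_mul_and_not_dvd (n := i) (by omega) Q (by omega)
      have hle : i' ≤ Q ^ s * i' := Nat.le_mul_of_pos_left _ (by positivity)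
      have hi0 : i' ≠ 0 := by rintro rfl; simp at hi'
      refine ⟨i', (s + j) % m, ⟨?_, Nat.mod_lt _ (by omega)⟩, ?_⟩
      · rw [hS, Finset.mem_filter, Finset.mem_Icc]
        exact ⟨by omega, hi'⟩
      · have hj' := (ZMod.intCast_eq_intCast_iff _ _ _).mpr hj
        push_cast at hj'
        have hx' : (x : ZMod (Q ^ m - 1)) = a + c * (i' * (Q : ZMod (Q ^ m - 1)) ^ (s + j)) := by
          rw [hj', add_mul, haj]
          ring
        change ZMod.val _ = x
        rw [← pow_eq_pow_mod _ hQm, ← hx', ZMod.val_natCast, Nat.mod_eq_of_lt hx]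
    · rintro ⟨i, t, ⟨hi, -⟩, rfl⟩
      refine ⟨i, (Finset.mem_filter.mp hi).1, ZMod.val_lt _, t, ?_⟩
      rw [← ZMod.intCast_eq_intCast_iff]
      push_cast
      rw [ZMod.natCast_zmod_val, add_mul, haj]
      ring
  have hinj : Set.InjOn f (S ×ˢ Finset.range m : Finset (ℕ × ℕ)) := by
    have hmem : ∀ p ∈ (S ×ˢ Finset.range m : Finset (ℕ × ℕ)),
        p.1 < Q ^ k ∧ ¬ Q ∣ p.1 ∧ p.2 < m := by
      intro p hp
      rw [Finset.mem_product, hS, Finset.mem_filter, Finset.mem_Icc, Finset.mem_range] at hp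
      refine ⟨lt_of_le_of_ne (by omega) ?_, hp.1.2, hp.2⟩
      intro h
      exact hp.1.2 (h ▸ dvd_pow_self Q hk0.ne')
    intro p hp r hr h
    exact injOn_mul_pow hQ hk hkm (hmem p hp) (hmem r hr)
      (hc.mul_left_cancel (add_left_cancel (ZMod.val_injective _ h)))
  rw [hU, hinj.ncard_image, Set.ncard_coe_finset, Finset.card_product, hS, card_filter_not_dvd,
    Finset.card_range]

/-- For `n = Qᵐ − 1`, `n̂ = n/e`, `2 ≤ δ ≤ Q^⌈m/2⌉ + 1`,
`|J⁺(δ)| = |J⁻(δ)| = (δ − 1 − ⌊(δ−1)/Q⌋)·m`. -/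
theorem stmt8 {q Q m e n nh δ : ℕ} (hq : IsPrimePow q) (hQ : Q = q ^ 2) (hm : 2 ≤ m)
    (he : e ∣ q + 1) (he0 : 0 < e) (hn : n = Q ^ m - 1) (hnh : nh = n / e)
    (hδ1 : 2 ≤ δ) (hδ2 : δ ≤ Q ^ ((m + 1) / 2) + 1) :
    (⋃ i ∈ Finset.Icc 1 (δ - 1), cycCoset Q n ((nh : ℤ) + i)).ncard
        = (δ - 1 - (δ - 1) / Q) * m ∧
    (⋃ i ∈ Finset.Icc 1 (δ - 1), cycCoset Q n ((nh : ℤ) - q * i)).ncard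
        = (δ - 1 - (δ - 1) / Q) * m := by
  subst hn
  have hq2 : 2 ≤ q := hq.two_le
  have hQ2 : 2 ≤ Q := by rw [hQ]; nlinarith
  have hQm : (Q : ZMod (Q ^ m - 1)) ^ m = 1 := ZMod.natCast_pow_eq_one_of_pred (by omega)
  have heQ : e ∣ Q - 1 := by
    refine he.trans ⟨q - 1, ?_⟩
    rw [hQ, ← Nat.sq_sub_sq q 1, one_pow]
  have hen : e ∣ Q ^ m - 1 := by
    refine heQ.trans ?_
    simpa using Nat.sub_dvd_pow_sub_pow Q 1 m
  have ha : (((nh : ℤ) : ℤ) : ZMod (Q ^ m - 1)) * Q = ((nh : ℤ) : ZMod (Q ^ m - 1)) := by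
    obtain ⟨r, hr⟩ := heQ
    have hne : nh * e = Q ^ m - 1 := by rw [hnh, Nat.div_mul_cancel hen]
    have hz : ((nh * e * r : ℕ) : ZMod (Q ^ m - 1)) = 0 := by rw [hne]; simp
    have hQr : Q = e * r + 1 := by omega
    have hcast : (Q : ZMod (Q ^ m - 1)) = e * r + 1 := by
      exact_mod_cast congrArg (Nat.cast : ℕ → ZMod (Q ^ m - 1)) hQr
    push_cast at hz ⊢
    rw [hcast]
    linear_combination hz
  have hu : IsUnit (q : ZMod (Q ^ m - 1)) := by
    refine IsUnit.of_pow_eq_one (n := 2 * m) ?_ (by omega)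
    rw [pow_mul, ← hQm]
    congr 1
    exact_mod_cast congrArg (Nat.cast : ℕ → ZMod (Q ^ m - 1)) hQ.symm
  constructor
  · have h := ncard_iUnion_cycCoset (k := (m + 1) / 2) (K := δ - 1) (c := 1) hQ2 (by omega)
      (by omega) (by omega) (by omega) ha (by simp)
    simpa only [one_mul] using h
  · have h := ncard_iUnion_cycCoset (k := (m + 1) / 2) (K := δ - 1) (c := -(q : ℤ)) hQ2 (by omega)
      (by omega) (by omega) (by omega) ha (by simpa using hu)
    simpa only [neg_mul, ← sub_eq_add_neg] using h
end
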